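/- arXiv:1102.2000 — 4 statements merged into one kernel-verified Lean document; each statement's English description precedes it below -/
import Mathlib

section
/- Let X be a Stone MV-space with MV-topology Ω and let Clop denote its set of clopen fuzzy subsets. Then for every x ∈ X, the set {o ∈ Clop : o(x) = 0} is a maximal ideal of Clop. -/
open Set unitInterval

noncomputable section

instance : Fact ((0:ℝ) ≤ 1) := ⟨zero_le_one⟩

noncomputable instance : CompleteLattice unitInterval := Set.Icc.completeLattice

namespace MVStone

/-- Truncated sum on [0,1]. -/
def oplus (a b : unitInterval) : unitInterval :=
  ⟨min (a.1 + b.1) 1, ⟨le_min (add_nonneg a.2.1 b.2.1) zero_le_one, min_le_right _ _⟩⟩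

/-- Truncated product (Łukasiewicz t-norm) on [0,1]. -/
def odot (a b : unitInterval) : unitInterval :=
  ⟨max (a.1 + b.1 - 1) 0, ⟨le_max_right _ _, max_le (by have := a.2.2; have := b.2.2; linarith) zero_le_one⟩⟩

/-- Truncated difference on [0,1]. -/
def ominus (a b : unitInterval) : unitInterval :=
  ⟨max (a.1 - b.1) 0, ⟨le_max_right _ _, max_le (by have := a.2.2; have := b.2.1; linarith) zero_le_one⟩⟩

variable {X : Type*}

def pOplus (α β : X → unitInterval) : X → unitInterval := fun x => oplus (α x) (β x)
def pOdot (α β : X → unitInterval) : X → unitInterval := fun x => odot (α x) (β x)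
def pStar (α : X → unitInterval) : X → unitInterval := fun x => σ (α x)
def pMin (α β : X → unitInterval) : X → unitInterval := fun x => min (α x) (β x)
def pMax (α β : X → unitInterval) : X → unitInterval := fun x => max (α x) (β x)

/-- Pointwise supremum of a family of fuzzy subsets. -/
def pSup (Γ : Set (X → unitInterval)) : X → unitInterval := fun x => ⨆ α ∈ Γ, α x
/-- Pointwise infimum of a family of fuzzy subsets. -/
def pInf (Γ : Set (X → unitInterval)) : X → unitInterval := fun x => ⨅ α ∈ Γ, α x

structure IsMVTopology (Ω : Set (X → unitInterval)) : Prop where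
  zero_mem : (fun _ => (0 : unitInterval)) ∈ Ω
  one_mem : (fun _ => (1 : unitInterval)) ∈ Ω
  sSup_mem : ∀ Γ ⊆ Ω, pSup Γ ∈ Ω
  oplus_mem : ∀ α ∈ Ω, ∀ β ∈ Ω, pOplus α β ∈ Ω
  odot_mem : ∀ α ∈ Ω, ∀ β ∈ Ω, pOdot α β ∈ Ω
  min_mem : ∀ α ∈ Ω, ∀ β ∈ Ω, pMin α β ∈ Ω

def IsCovering (Γ : Set (X → unitInterval)) : Prop := pSup Γ = fun _ => 1

/-- `⊕`-sum of a finite list of fuzzy subsets. -/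
def sumList (l : List (X → unitInterval)) : X → unitInterval :=
  l.foldr pOplus (fun _ => 0)

/-- Compactness: every open covering contains a finite list whose `⊕`-sum is `1`. -/
def MVCompact (Ω : Set (X → unitInterval)) : Prop :=
  ∀ Γ ⊆ Ω, IsCovering Γ →
    ∃ l : List (X → unitInterval), (∀ o ∈ l, o ∈ Γ) ∧ sumList l = fun _ => 1

/-- Strong compactness: every open covering contains a finite subcovering. -/
def MVStronglyCompact (Ω : Set (X → unitInterval)) : Prop :=
  ∀ Γ ⊆ Ω, IsCovering Γ → ∃ F ⊆ Γ, F.Finite ∧ IsCovering F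

def MVHausdorff (Ω : Set (X → unitInterval)) : Prop :=
  ∀ x y : X, x ≠ y → ∃ ox ∈ Ω, ∃ oy ∈ Ω,
    ox x = 1 ∧ oy y = 1 ∧ pMin ox oy = fun _ => 0

def IsBase (Ω Θ : Set (X → unitInterval)) : Prop :=
  Θ ⊆ Ω ∧ ∀ o ∈ Ω, ∃ G ⊆ Θ, o = pSup G

def MVClopen (Ω : Set (X → unitInterval)) (α : X → unitInterval) : Prop :=
  α ∈ Ω ∧ pStar α ∈ Ω

def Clop (Ω : Set (X → unitInterval)) : Set (X → unitInterval) := {α | MVClopen Ω α}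

def IsStoneMVSpace (Ω : Set (X → unitInterval)) : Prop :=
  IsMVTopology Ω ∧ MVCompact Ω ∧ MVHausdorff Ω ∧
    ∃ Θ, IsBase Ω Θ ∧ ∀ θ ∈ Θ, MVClopen Ω θ

/-- Ideal of a set `A` of fuzzy subsets closed under `⊕` (w.r.t. the pointwise order). -/
def IsIdealOf (A M : Set (X → unitInterval)) : Prop :=
  M ⊆ A ∧ (fun _ => (0 : unitInterval)) ∈ M ∧ (∀ a ∈ M, ∀ b ∈ M, pOplus a b ∈ M) ∧
    ∀ a ∈ A, ∀ b ∈ M, a ≤ b → a ∈ M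

def IsMaximalIdealOf (A M : Set (X → unitInterval)) : Prop :=
  IsIdealOf A M ∧ M ≠ A ∧ ∀ N, IsIdealOf A N → N ≠ A → M ⊆ N → M = N


theorem pStar_zero {X : Type*} : pStar (fun _ : X => 0) = fun _ => 1 :=
  funext fun _ => unitInterval.symm_zero

theorem pStar_pStar {X : Type*} (α : X → unitInterval) : pStar (pStar α) = α :=
  funext fun x => unitInterval.symm_symm (α x)

theorem pStar_pOplus {X : Type*} (α β : X → unitInterval) :
    pStar (pOplus α β) = pOdot (pStar α) (pStar β) := by
  funext x
  apply Subtype.ext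
  simp only [pStar, pOplus, pOdot, oplus, odot, unitInterval.coe_symm_eq]
  rcases le_total ((α x : ℝ) + β x) 1 with h | h
  · rw [min_eq_left h, max_eq_left] <;> linarith
  · rw [min_eq_right h, max_eq_right] <;> linarith

theorem pOplus_mem_Clop {X : Type*} {Ω : Set (X → unitInterval)} (hΩ : IsMVTopology Ω)
    {α β : X → unitInterval} (hα : α ∈ Clop Ω) (hβ : β ∈ Clop Ω) : pOplus α β ∈ Clop Ω := by
  refine ⟨hΩ.oplus_mem _ hα.1 _ hβ.1, ?_⟩
  rw [pStar_pOplus]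
  exact hΩ.odot_mem _ hα.2 _ hβ.2

theorem zero_mem_Clop {X : Type*} {Ω : Set (X → unitInterval)} (hΩ : IsMVTopology Ω) :
    (fun _ => 0) ∈ Clop Ω :=
  ⟨hΩ.zero_mem, pStar_zero ▸ hΩ.one_mem⟩

theorem pStar_mem_Clop {X : Type*} {Ω : Set (X → unitInterval)} {α : X → unitInterval}
    (hα : α ∈ Clop Ω) : pStar α ∈ Clop Ω :=
  ⟨hα.2, (pStar_pStar α).symm ▸ hα.1⟩

theorem one_mem_Clop {X : Type*} {Ω : Set (X → unitInterval)} (hΩ : IsMVTopology Ω) :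
    (fun _ => 1) ∈ Clop Ω :=
  pStar_zero ▸ pStar_mem_Clop (zero_mem_Clop hΩ)

theorem pOplus_pStar {X : Type*} (α : X → unitInterval) : pOplus α (pStar α) = fun _ => 1 := by
  funext x
  apply Subtype.ext
  simp [pStar, pOplus, oplus]

/-- Finitely many truncated summands equal to `a` dominate the truncation of `n * a x`. -/
theorem IsIdealOf.exists_min_mul_le {X : Type*} {A M : Set (X → unitInterval)}
    (hM : IsIdealOf A M) {a : X → unitInterval} (ha : a ∈ M) (x : X) (n : ℕ) :
    ∃ b ∈ M, min (n * (a x : ℝ)) 1 ≤ b x := by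
  induction n with
  | zero => exact ⟨_, hM.2.1, by simp⟩
  | succ n ih =>
    obtain ⟨b, hb, hle⟩ := ih
    refine ⟨pOplus b a, hM.2.2.1 b hb a ha, ?_⟩
    have h0 : (0 : ℝ) ≤ a x := (a x).2.1
    simp only [pOplus, oplus, Nat.cast_add, Nat.cast_one, add_mul, one_mul]
    refine le_min ?_ (min_le_right _ _)
    rcases le_total (n * (a x : ℝ)) 1 with h | h
    · rw [min_eq_left h] at hle
      exact (min_le_left _ _).trans (by linarith)
    · rw [min_eq_right h] at hle
      exact (min_le_right _ _).trans (by linarith)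

theorem IsIdealOf.exists_eq_one {X : Type*} {A M : Set (X → unitInterval)}
    (hM : IsIdealOf A M) {a : X → unitInterval} (ha : a ∈ M) {x : X} (hx : a x ≠ 0) :
    ∃ b ∈ M, b x = 1 := by
  have hpos : (0 : ℝ) < a x := unitInterval.coe_pos.2 (unitInterval.pos_iff_ne_zero.2 hx)
  obtain ⟨n, hn⟩ := exists_nat_ge (1 / (a x : ℝ))
  obtain ⟨b, hb, hle⟩ := hM.exists_min_mul_le ha x n
  rw [min_eq_right ((div_le_iff₀ hpos).1 hn)] at hle
  exact ⟨b, hb, Subtype.ext (le_antisymm (b x).2.2 hle)⟩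

theorem IsIdealOf.eq_of_one_mem {X : Type*} {A M : Set (X → unitInterval)}
    (hM : IsIdealOf A M) (h1 : (fun _ => 1) ∈ M) : M = A :=
  hM.1.antisymm fun a ha => hM.2.2.2 a ha _ h1 fun y => (a y).2.2

theorem isIdealOf_vanishing {X : Type*} {Ω : Set (X → unitInterval)} (hΩ : IsMVTopology Ω)
    (x : X) : IsIdealOf (Clop Ω) {o ∈ Clop Ω | o x = 0} := by
  refine ⟨fun o ho => ho.1, ⟨zero_mem_Clop hΩ, rfl⟩, ?_, ?_⟩
  · rintro a ⟨ha, hax⟩ b ⟨hb, hbx⟩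
    refine ⟨pOplus_mem_Clop hΩ ha hb, Subtype.ext ?_⟩
    simp [pOplus, oplus, hax, hbx]
  · rintro a ha b ⟨-, hbx⟩ hab
    exact ⟨ha, le_antisymm (hbx ▸ hab x) (a x).2.1⟩

theorem stmt1 {X : Type*} (Ω : Set (X → unitInterval)) (h : IsStoneMVSpace Ω) (x : X) :
    IsMaximalIdealOf (Clop Ω) {o ∈ Clop Ω | o x = 0} := by
  have hΩ := h.1
  refine ⟨isIdealOf_vanishing hΩ x, fun heq => ?_, fun N hN hne hle => ?_⟩
  · have h1 := one_mem_Clop hΩ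
    rw [← heq] at h1
    exact one_ne_zero h1.2
  · refine hle.antisymm fun a ha => ⟨hN.1 ha, ?_⟩
    by_contra hax
    obtain ⟨b, hb, hbx⟩ := hN.exists_eq_one ha hax
    have hb' : pStar b ∈ N := hle ⟨pStar_mem_Clop (hN.1 hb), by simp [pStar, hbx]⟩
    exact hne (hN.eq_of_one_mem (pOplus_pStar b ▸ hN.2.2.1 b hb _ hb'))

end MVStone
end
end

section
/- Let A be an MV-subalgebra of [0,1]^S with the property that every family Γ ⊆ A whose pointwise supremum is the constant function 1 contains a finite subfamily whose pointwise supremum is 1. Then for all subsets X, Y of A and every α : S → [0,1], if α is simultaneously the pointwise supremum of X and the pointwise infimum of Y, then α ∈ A (that is, A is limit cut complete). -/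
open Set unitInterval

noncomputable section

namespace MVStone

variable {X : Type*}

variable {S : Type*}

/-- MV-subalgebra of `[0,1]^S`. -/
def IsMVSubalgebra (A : Set (S → unitInterval)) : Prop :=
  (fun _ => (0 : unitInterval)) ∈ A ∧ (∀ a ∈ A, ∀ b ∈ A, pOplus a b ∈ A) ∧
    ∀ a ∈ A, pStar a ∈ A

/-- Upper bounds of `X` within `A` (pointwise order). -/
def ub (A X : Set (S → unitInterval)) : Set (S → unitInterval) := {b ∈ A | ∀ a ∈ X, a ≤ b}

/-- Lower bounds of `X` within `A` (pointwise order). -/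
def lb (A X : Set (S → unitInterval)) : Set (S → unitInterval) := {b ∈ A | ∀ a ∈ X, b ≤ a}

/-- `X` is a cut of `A` iff `X = l(uX)`. -/
def IsCutOf (A X : Set (S → unitInterval)) : Prop := X = lb A (ub A X)

/-- The limit condition: the pointwise infimum, over `a ∈ X` and `b ∈ uX`, of the truncated
difference `b ⊖ a` is the zero function. -/
def LimitCond (A X : Set (S → unitInterval)) : Prop :=
  pInf {γ | ∃ a ∈ X, ∃ b ∈ ub A X, γ = fun s => ominus (b s) (a s)} =
    fun _ => (0 : unitInterval)

/-- A limit cut is a cut satisfying the limit condition. -/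
def IsLimitCutOf (A X : Set (S → unitInterval)) : Prop := IsCutOf A X ∧ LimitCond A X

/-- `A` is limit cut complete: the pointwise supremum of every limit cut of `A` belongs
to `A`. -/
def IsLcc (A : Set (S → unitInterval)) : Prop :=
  ∀ X : Set (S → unitInterval), IsLimitCutOf A X → pSup X ∈ A

theorem le_pSup {Γ : Set (S → unitInterval)} {a : S → unitInterval} (ha : a ∈ Γ) (s : S) :
    a s ≤ pSup Γ s :=
  le_iSup₂ (f := fun (b : S → unitInterval) (_ : b ∈ Γ) => b s) a ha

theorem pSup_le {Γ : Set (S → unitInterval)} {s : S} {c : unitInterval}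
    (h : ∀ a ∈ Γ, a s ≤ c) : pSup Γ s ≤ c :=
  iSup₂_le h

theorem pInf_le {Γ : Set (S → unitInterval)} {a : S → unitInterval} (ha : a ∈ Γ) (s : S) :
    pInf Γ s ≤ a s :=
  iInf₂_le (f := fun (b : S → unitInterval) (_ : b ∈ Γ) => b s) a ha

theorem le_pInf {Γ : Set (S → unitInterval)} {s : S} {c : unitInterval}
    (h : ∀ a ∈ Γ, c ≤ a s) : c ≤ pInf Γ s :=
  le_iInf₂ h

theorem exists_lt_of_lt_pSup {Γ : Set (S → unitInterval)} (hΓ : Γ.Nonempty) {s : S} {r : ℝ}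
    (h : r < (pSup Γ s : ℝ)) : ∃ a ∈ Γ, r < (a s : ℝ) := by
  by_contra! hc
  obtain ⟨a, ha⟩ := hΓ
  have h0 : 0 ≤ r := (a s).2.1.trans (hc a ha)
  have h1 : r ≤ 1 := h.le.trans (pSup Γ s).2.2
  exact h.not_ge (pSup_le (c := ⟨r, h0, h1⟩) hc)

theorem exists_lt_of_pInf_lt {Γ : Set (S → unitInterval)} (hΓ : Γ.Nonempty) {s : S} {r : ℝ}
    (h : (pInf Γ s : ℝ) < r) : ∃ a ∈ Γ, (a s : ℝ) < r := by
  by_contra! hc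
  obtain ⟨a, ha⟩ := hΓ
  have h0 : 0 ≤ r := (pInf Γ s).2.1.trans h.le
  have h1 : r ≤ 1 := (hc a ha).trans (a s).2.2
  exact h.not_ge (le_pInf (c := ⟨r, h0, h1⟩) hc)

theorem pSup_empty : pSup (∅ : Set (S → unitInterval)) = fun _ => 0 :=
  funext fun _ => le_antisymm (pSup_le (by simp)) (unitInterval.nonneg _)

theorem pInf_empty : pInf (∅ : Set (S → unitInterval)) = fun _ => 1 :=
  funext fun _ => le_antisymm (unitInterval.le_one _) (le_pInf (by simp))

theorem pSup_insert (a : S → unitInterval) (Γ : Set (S → unitInterval)) :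
    pSup (insert a Γ) = pMax a (pSup Γ) := by
  funext s
  apply le_antisymm
  · refine pSup_le fun b hb => ?_
    rcases hb with rfl | hb
    · exact le_max_left _ _
    · exact (le_pSup hb s).trans (le_max_right _ _)
  · refine max_le (le_pSup (mem_insert _ _) s) (pSup_le fun b hb => ?_)
    exact le_pSup (mem_insert_of_mem _ hb) s

theorem IsMVSubalgebra.pMax_mem {A : Set (S → unitInterval)} (hA : IsMVSubalgebra A)
    {a b : S → unitInterval} (ha : a ∈ A) (hb : b ∈ A) : pMax a b ∈ A := by
  have h : pMax a b = pOplus (pStar (pOplus (pStar a) b)) b := by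
    funext s
    apply Subtype.ext
    have ha := (a s).2.2
    have hb := (b s).2.2
    rcases le_total (a s) (b s) with hab | hab
    · have hab' : (a s : ℝ) ≤ b s := hab
      simp only [pMax, pOplus, pStar, oplus, unitInterval.coe_symm_eq, max_eq_right hab]
      grind
    · have hab' : (b s : ℝ) ≤ a s := hab
      simp only [pMax, pOplus, pStar, oplus, unitInterval.coe_symm_eq, max_eq_left hab]
      grind
  rw [h]
  exact hA.2.1 _ (hA.2.2 _ (hA.2.1 _ (hA.2.2 _ ha) _ hb)) _ hb

theorem IsMVSubalgebra.pSup_mem_of_finite {A : Set (S → unitInterval)} (hA : IsMVSubalgebra A)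
    {F : Set (S → unitInterval)} (hF : F.Finite) (hFA : F ⊆ A) : pSup F ∈ A := by
  induction F, hF using Set.Finite.induction_on with
  | empty => rw [pSup_empty]; exact hA.1
  | @insert a F _ _ ih =>
    rw [pSup_insert]
    exact hA.pMax_mem (hFA (mem_insert _ _)) (ih ((subset_insert _ _).trans hFA))

/-- The supremum of a nonempty finite family is attained at each point. -/
theorem exists_eq_pSup_of_finite {F : Set (S → unitInterval)} (hF : F.Finite)
    (hne : F.Nonempty) (s : S) : ∃ a ∈ F, a s = pSup F s := by
  obtain ⟨a, ha, hmax⟩ := Set.exists_max_image F (fun b => b s) hF hne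
  exact ⟨a, ha, le_antisymm (le_pSup ha s) (pSup_le hmax)⟩

theorem pSup_pOplus_pStar_eq_one {X Y : Set (S → unitInterval)} (hX : X.Nonempty)
    (hY : Y.Nonempty) (hXY : pSup X = pInf Y) :
    pSup {γ | ∃ a ∈ X, ∃ b ∈ Y, γ = pOplus a (pStar b)} = fun _ => 1 := by
  funext s
  refine le_antisymm (unitInterval.le_one _) ?_
  set Γ := {γ | ∃ a ∈ X, ∃ b ∈ Y, γ = pOplus a (pStar b)}
  by_contra! hlt
  have hlt' : (pSup Γ s : ℝ) < 1 := hlt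
  obtain ⟨a, ha, has⟩ := exists_lt_of_lt_pSup hX (s := s)
    (r := (pSup X s : ℝ) - (1 - (pSup Γ s : ℝ)) / 2) (by linarith)
  obtain ⟨b, hb, hbs⟩ := exists_lt_of_pInf_lt hY (s := s)
    (r := (pInf Y s : ℝ) + (1 - (pSup Γ s : ℝ)) / 2) (by linarith)
  have hle : min ((a s : ℝ) + (1 - b s)) 1 ≤ (pSup Γ s : ℝ) :=
    le_pSup (Γ := Γ) (a := pOplus a (pStar b)) ⟨a, ha, b, hb, rfl⟩ s
  rw [hXY] at has
  rcases min_le_iff.mp hle with h | h <;> linarith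

theorem mem_of_eq_pSup_of_eq_pInf {A : Set (S → unitInterval)} (hA : IsMVSubalgebra A)
    (hcomp : ∀ Γ ⊆ A, pSup Γ = (fun _ => (1 : unitInterval)) →
      ∃ F ⊆ Γ, F.Finite ∧ pSup F = fun _ => (1 : unitInterval))
    {X Y : Set (S → unitInterval)} (hX : X ⊆ A) (hY : Y ⊆ A) (hXY : pSup X = pInf Y) :
    pSup X ∈ A := by
  rcases X.eq_empty_or_nonempty with rfl | hXne
  · rw [pSup_empty]
    exact hA.1
  rcases Y.eq_empty_or_nonempty with rfl | hYne
  · have h : pStar (fun _ : S => (0 : unitInterval)) = fun _ => 1 :=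
      funext fun _ => unitInterval.symm_zero
    rw [hXY, pInf_empty, ← h]
    exact hA.2.2 _ hA.1
  obtain ⟨F, hFΓ, hF, hF1⟩ := hcomp {γ | ∃ a ∈ X, ∃ b ∈ Y, γ = pOplus a (pStar b)}
    (by
      rintro _ ⟨a, ha, b, hb, rfl⟩
      exact hA.2.1 _ (hX ha) _ (hA.2.2 _ (hY hb)))
    (pSup_pOplus_pStar_eq_one hXne hYne hXY)
  have hFΓ' : ∀ γ ∈ F, ∃ a ∈ X, ∃ b ∈ Y, γ = pOplus a (pStar b) := fun γ hγ => hFΓ hγ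
  choose! f hfX g hgY hfg using hFΓ'
  have hfF : f '' F ⊆ X := image_subset_iff.mpr hfX
  suffices h : pSup X = pSup (f '' F) by
    rw [h]
    exact hA.pSup_mem_of_finite (hF.image f) (hfF.trans hX)
  funext s
  refine le_antisymm ?_ (pSup_le fun a ha => le_pSup (hfF ha) s)
  have hFne : F.Nonempty := by
    rw [nonempty_iff_ne_empty]
    rintro rfl
    rw [pSup_empty] at hF1
    exact zero_ne_one (congrFun hF1 s)
  obtain ⟨γ, hγ, hγs⟩ := exists_eq_pSup_of_finite hF hFne s
  rw [hF1, hfg γ hγ] at hγs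
  have hmin : min ((f γ s : ℝ) + (1 - g γ s)) 1 = 1 := congrArg Subtype.val hγs
  have hgf : g γ s ≤ f γ s := by
    have := min_eq_right_iff.mp hmin
    exact Subtype.coe_le_coe.mp (by linarith)
  calc pSup X s = pInf Y s := congrFun hXY s
    _ ≤ g γ s := pInf_le (hgY γ hγ) s
    _ ≤ f γ s := hgf
    _ ≤ pSup (f '' F) s := le_pSup (mem_image_of_mem f hγ) s

theorem LimitCond.pSup_eq_pInf_ub {A X : Set (S → unitInterval)} (h : LimitCond A X) :
    pSup X = pInf (ub A X) := by
  funext s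
  refine le_antisymm (pSup_le fun a ha => le_pInf fun b hb => hb.2 a ha s) ?_
  set Γ := {γ | ∃ a ∈ X, ∃ b ∈ ub A X, γ = fun s => ominus (b s) (a s)}
  have hs : pInf Γ s = 0 := congrFun h s
  have hle : (pInf (ub A X) s : ℝ) - pSup X s ≤ pInf Γ s := by
    by_contra! hlt
    have hne : Γ.Nonempty := by
      rw [nonempty_iff_ne_empty]
      intro he
      rw [he, pInf_empty] at hs
      exact one_ne_zero hs
    obtain ⟨_, ⟨a, ha, b, hb, rfl⟩, hab⟩ := exists_lt_of_pInf_lt hne hlt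
    have h1 : (b s : ℝ) - a s ≤ ominus (b s) (a s) := le_max_left _ _
    have h2 : (a s : ℝ) ≤ pSup X s := le_pSup ha s
    have h3 : (pInf (ub A X) s : ℝ) ≤ b s := pInf_le hb s
    linarith
  rw [hs] at hle
  exact Subtype.coe_le_coe.mp (sub_nonpos.mp hle)

theorem stmt4 {S : Type*} (A : Set (S → unitInterval)) (hA : IsMVSubalgebra A)
    (hcomp : ∀ Γ ⊆ A, pSup Γ = (fun _ => (1 : unitInterval)) →
      ∃ F ⊆ Γ, F.Finite ∧ pSup F = fun _ => (1 : unitInterval)) :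
    (∀ X ⊆ A, ∀ Y ⊆ A, ∀ α : S → unitInterval, α = pSup X → α = pInf Y → α ∈ A) ∧
    IsLcc A := by
  refine ⟨fun X hX Y hY α hαX hαY => ?_, fun X hX => ?_⟩
  · rw [hαX]
    exact mem_of_eq_pSup_of_eq_pInf hA hcomp hX hY (hαX.symm.trans hαY)
  · have hXA : X ⊆ A := by
      rw [hX.1]
      exact fun a ha => ha.1
    exact mem_of_eq_pSup_of_eq_pInf hA hcomp hXA (fun b hb => hb.1) hX.2.pSup_eq_pInf_ub

end MVStone
end
end

section
/- Let X be a strongly compact Stone MV-space. Then for every x ∈ X, the set of values {α(x) : α a clopen fuzzy subset of X} is a finite subset of [0,1]. -/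
open Set unitInterval

noncomputable section

namespace MVStone

variable {X : Type*}

theorem le_pSup_s6 {X : Type*} {Γ : Set (X → unitInterval)} {α : X → unitInterval} (hα : α ∈ Γ)
    (x : X) : α x ≤ pSup Γ x :=
  le_iSup₂ (f := fun (β : X → unitInterval) (_ : β ∈ Γ) => β x) α hα

theorem pSup_le_s6 {X : Type*} {Γ : Set (X → unitInterval)} {x : X} {m : unitInterval}
    (h : ∀ α ∈ Γ, α x ≤ m) : pSup Γ x ≤ m :=
  iSup₂_le h

/-- A finite covering attains the value `1` at every point. -/
theorem IsCovering.exists_eq_one {X : Type*} {F : Set (X → unitInterval)} (hF : F.Finite)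
    (hc : IsCovering F) (x : X) : ∃ α ∈ F, α x = 1 := by
  by_contra! hne
  rcases F.eq_empty_or_nonempty with rfl | hn
  · have h0 : pSup (∅ : Set (X → unitInterval)) x ≤ 0 := pSup_le_s6 (by simp)
    rw [congrFun hc x] at h0
    exact absurd h0 (not_le.2 zero_lt_one)
  · obtain ⟨β, hβ, hmax⟩ := Set.exists_max_image F (fun α => α x) hF hn
    have h1 : pSup F x ≤ β x := pSup_le_s6 hmax
    rw [congrFun hc x] at h1
    exact hne β hβ (le_antisymm unitInterval.le_one' h1)

/-- In a strongly compact Hausdorff MV-space, the open values at a point that differ from `1` are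
bounded away from `1`. -/
theorem exists_lt_one_of_stronglyCompact {X : Type*} {Ω : Set (X → unitInterval)}
    (hH : MVHausdorff Ω) (hsc : MVStronglyCompact Ω) (x : X) :
    ∃ m : unitInterval, m < 1 ∧ ∀ α ∈ Ω, α x ≠ 1 → α x ≤ m := by
  have hΓ : {α ∈ Ω | α x ≠ 1} ⊆ Ω := fun α hα => hα.1
  refine ⟨pSup {α ∈ Ω | α x ≠ 1} x, lt_of_le_of_ne unitInterval.le_one' fun hx => ?_,
    fun α hα hα1 => le_pSup_s6 (Γ := {α ∈ Ω | α x ≠ 1}) ⟨hα, hα1⟩ x⟩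
  have hcov : IsCovering {α ∈ Ω | α x ≠ 1} := by
    funext y
    by_cases hxy : x = y
    · rw [← hxy, hx]
    obtain ⟨o, -, p, hp, hox, hpy, hop⟩ := hH x y hxy
    have hpx : p x ≠ 1 := fun hpx => by
      simpa [pMin, hox, hpx] using congrFun hop x
    exact le_antisymm unitInterval.le_one'
      (hpy ▸ le_pSup_s6 (Γ := {α ∈ Ω | α x ≠ 1}) ⟨hp, hpx⟩ y)
  obtain ⟨F, hFΓ, hF, hFc⟩ := hsc _ hΓ hcov
  obtain ⟨α, hα, hα1⟩ := hFc.exists_eq_one hF x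
  exact (hFΓ hα).2 hα1

/-- A subset of `[0,1]` whose points are uniformly separated is finite. -/
theorem finite_of_forall_lt_le_sub {S : Set unitInterval} {δ : ℝ} (hδ : 0 < δ)
    (h : ∀ a ∈ S, ∀ b ∈ S, a < b → δ ≤ (b : ℝ) - a) : S.Finite := by
  refine Set.Finite.of_injOn (f := fun v : unitInterval => ⌊(v : ℝ) / δ⌋₊)
    (t := Set.Iic ⌊1 / δ⌋₊) (fun v _ => ?_) ?_ (Set.finite_Iic _)
  · exact Nat.floor_le_floor (div_le_div_of_nonneg_right v.2.2 hδ.le)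
  · have key : ∀ a ∈ S, ∀ b ∈ S, a < b → ⌊(a : ℝ) / δ⌋₊ ≠ ⌊(b : ℝ) / δ⌋₊ := by
      intro a ha b hb hab heq
      have h1 : (⌊(a : ℝ) / δ⌋₊ : ℝ) ≤ a / δ := Nat.floor_le (div_nonneg a.2.1 hδ.le)
      have h2 : (b : ℝ) / δ < ⌊(b : ℝ) / δ⌋₊ + 1 := Nat.lt_floor_add_one _
      rw [← heq] at h2
      have h3 : (b : ℝ) / δ < a / δ + 1 := by linarith
      rw [div_add_one hδ.ne', div_lt_div_iff_of_pos_right hδ] at h3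
      linarith [h a ha b hb hab]
    intro a ha b hb hab
    rcases lt_trichotomy a b with hlt | heq | hlt
    · exact absurd hab (key a ha b hb hlt)
    · exact heq
    · exact absurd hab.symm (key b hb a ha hlt)

theorem stmt6 {X : Type*} (Ω : Set (X → unitInterval))
    (h : IsStoneMVSpace Ω) (hsc : MVStronglyCompact Ω) (x : X) :
    {v : unitInterval | ∃ α ∈ Clop Ω, α x = v}.Finite := by
  obtain ⟨hΩ, -, hH, -⟩ := h
  obtain ⟨m, hm, hle⟩ := exists_lt_one_of_stronglyCompact hH hsc x
  refine finite_of_forall_lt_le_sub (sub_pos.2 (Subtype.coe_lt_coe.2 hm)) ?_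
  rintro _ ⟨α, hα, rfl⟩ _ ⟨β, hβ, rfl⟩ hlt
  have hlt' : (α x : ℝ) < β x := hlt
  have hval : (pOplus α (pStar β) x : ℝ) = 1 - (β x - α x) := by
    change min ((α x : ℝ) + (1 - β x)) 1 = _
    rw [min_eq_left (by linarith)]
    ring
  have hne : pOplus α (pStar β) x ≠ 1 := fun he => by
    rw [he, Set.Icc.coe_one] at hval
    linarith
  have hbound : (pOplus α (pStar β) x : ℝ) ≤ m := hle _ (hΩ.oplus_mem α hα.1 _ hβ.2) hne
  rw [Set.Icc.coe_one]
  linarith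

end MVStone
end
end

section
/- Let X be a nonempty set and let Ω be the set of all constant functions from X to [0,1]. Then Ω is an MV-topology on X, the MV-topological space ⟨X, Ω⟩ is compact, but ⟨X, Ω⟩ is not strongly compact. -/
open Set unitInterval

noncomputable section

namespace MVStone

variable {X : Type*}

theorem pSup_apply_le {Γ : Set (X → unitInterval)} {x : X} {b : unitInterval}
    (h : ∀ α ∈ Γ, α x ≤ b) : pSup Γ x ≤ b :=
  iSup₂_le h

theorem le_pSup_apply {Γ : Set (X → unitInterval)} {α : X → unitInterval} (hα : α ∈ Γ) (x : X) :
    α x ≤ pSup Γ x :=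
  le_iSup₂ (f := fun (α : X → unitInterval) (_ : α ∈ Γ) => α x) α hα

theorem IsCovering.exists_lt {Γ : Set (X → unitInterval)} (h : IsCovering Γ) (x : X)
    {b : unitInterval} (hb : b < 1) : ∃ α ∈ Γ, b < α x := by
  by_contra! hle
  exact hb.not_ge (congrFun h x ▸ pSup_apply_le hle)

/-- A finite covering attains the value `1` at every point. -/
theorem IsCovering.exists_eq_one_of_finite {F : Set (X → unitInterval)} (h : IsCovering F)
    (hF : F.Finite) (x : X) : ∃ α ∈ F, α x = 1 := by
  obtain ⟨α₀, hα₀, -⟩ := h.exists_lt x zero_lt_one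
  obtain ⟨α, hα, hmax⟩ := Set.exists_max_image F (fun β => β x) hF ⟨α₀, hα₀⟩
  exact ⟨α, hα, le_antisymm unitInterval.le_one' (congrFun h x ▸ pSup_apply_le hmax)⟩

theorem isMVTopology_const :
    IsMVTopology {α : X → unitInterval | ∃ c : unitInterval, α = fun _ => c} where
  zero_mem := ⟨0, rfl⟩
  one_mem := ⟨1, rfl⟩
  sSup_mem Γ hΓ := by
    rcases isEmpty_or_nonempty X with _ | ⟨⟨x₀⟩⟩
    · exact ⟨0, Subsingleton.elim _ _⟩
    · have hle (x y : X) : pSup Γ x ≤ pSup Γ y := pSup_apply_le fun α hα => by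
        obtain ⟨c, rfl⟩ := hΓ hα
        exact le_pSup_apply hα y
      exact ⟨pSup Γ x₀, funext fun x => le_antisymm (hle x x₀) (hle x₀ x)⟩
  oplus_mem := by
    rintro _ ⟨a, rfl⟩ _ ⟨b, rfl⟩
    exact ⟨oplus a b, rfl⟩
  odot_mem := by
    rintro _ ⟨a, rfl⟩ _ ⟨b, rfl⟩
    exact ⟨odot a b, rfl⟩
  min_mem := by
    rintro _ ⟨a, rfl⟩ _ ⟨b, rfl⟩
    exact ⟨min a b, rfl⟩

theorem mvCompact_const :
    MVCompact {α : X → unitInterval | ∃ c : unitInterval, α = fun _ => c} := by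
  intro Γ hΓ hcov
  rcases isEmpty_or_nonempty X with _ | ⟨⟨x₀⟩⟩
  · exact ⟨[], by simp, Subsingleton.elim _ _⟩
  · have hhalf : (⟨1 / 2, by norm_num, by norm_num⟩ : unitInterval) < 1 :=
      Subtype.mk_lt_mk.2 (by norm_num)
    obtain ⟨α, hα, hlt⟩ := hcov.exists_lt x₀ hhalf
    obtain ⟨c, rfl⟩ := hΓ hα
    have hc : (1 / 2 : ℝ) < c.1 := hlt
    refine ⟨[fun _ => c, fun _ => c], by simpa using hα, funext fun x => Subtype.ext ?_⟩
    change min (c.1 + min (c.1 + 0) 1) 1 = 1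
    rw [add_zero, min_eq_left c.2.2]
    exact min_eq_right (by linarith)

theorem not_mvStronglyCompact_const [Nonempty X] :
    ¬ MVStronglyCompact {α : X → unitInterval | ∃ c : unitInterval, α = fun _ => c} := by
  intro h
  let Γ : Set (X → unitInterval) := {α | ∃ c : unitInterval, c < 1 ∧ α = fun _ => c}
  have hcov : IsCovering Γ := funext fun x =>
    le_antisymm unitInterval.le_one' <| le_of_forall_lt_imp_le_of_dense fun c hc =>
      le_pSup_apply (Γ := Γ) (α := fun _ => c) ⟨c, hc, rfl⟩ x
  obtain ⟨F, hFΓ, hF, hFcov⟩ := h Γ (fun _ ⟨c, _, hα⟩ => ⟨c, hα⟩) hcov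
  obtain ⟨α, hα, h1⟩ := hFcov.exists_eq_one_of_finite hF (Classical.arbitrary X)
  obtain ⟨c, hc, rfl⟩ := hFΓ hα
  exact hc.ne h1

theorem stmt16 {X : Type*} [Nonempty X] :
    IsMVTopology {α : X → unitInterval | ∃ c : unitInterval, α = fun _ => c} ∧
    MVCompact {α : X → unitInterval | ∃ c : unitInterval, α = fun _ => c} ∧
    ¬ MVStronglyCompact {α : X → unitInterval | ∃ c : unitInterval, α = fun _ => c} :=
  ⟨isMVTopology_const, mvCompact_const, not_mvStronglyCompact_const⟩

end MVStone
end
end
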